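/- Let h be a finite-dimensional complex vector space and Γ a finite subgroup of GL(h) generated by reflections (elements γ with rank(γ − 1) = 1). Then a subgroup Γ' of Γ is the stabilizer of some vector of h (for the natural action of Γ on h) if and only if Γ' is the stabilizer of some vector of h ⊕ h* (for the diagonal action of Γ on h ⊕ h*). [Lemma: 'Γ' is a stabilizer subgroup of (Γ,h) if and only if it is a stabilizer subgroup of (Γ, h ⊕ h*)'.] -/

import Mathlib

/-- The sum over a finite group `G` of its translates of a vector is fixed by `G`. -/
theorem LinearEquiv.apply_sum_subgroup_apply {K V : Type*} [Field K] [AddCommGroup V] [Module K V]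
    (G : Subgroup (V ≃ₗ[K] V)) [Fintype G] {g : V ≃ₗ[K] V} (hg : g ∈ G) (x : V) :
    g (∑ k : G, (k : V ≃ₗ[K] V) x) = ∑ k : G, (k : V ≃ₗ[K] V) x := by
  rw [map_sum]
  exact Fintype.sum_equiv (Equiv.mulLeft (⟨g, hg⟩ : G)) _ _ fun _ ↦ rfl

/-- The sum over a finite group `G` of the translates of a vector is invariant under translating
that vector by `G`. -/
theorem LinearEquiv.sum_subgroup_apply_apply {K V : Type*} [Field K] [AddCommGroup V] [Module K V]
    (G : Subgroup (V ≃ₗ[K] V)) [Fintype G] {g : V ≃ₗ[K] V} (hg : g ∈ G) (x : V) :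
    ∑ k : G, (k : V ≃ₗ[K] V) (g x) = ∑ k : G, (k : V ≃ₗ[K] V) x :=
  Fintype.sum_equiv (Equiv.mulRight (⟨g, hg⟩ : G)) _ _ fun _ ↦ rfl

/-- If two finite groups `H ≤ G` have the same fixed vectors, then every linear form invariant
under `H` is invariant under `G`. -/
theorem Module.Dual.apply_eq_of_fixed_vectors_eq {K V : Type*} [Field K] [CharZero K]
    [AddCommGroup V] [Module K V] {H G : Subgroup (V ≃ₗ[K] V)} [Finite G] (hHG : H ≤ G)
    (hfix : ∀ x : V, (∀ k ∈ H, k x = x) → ∀ k ∈ G, k x = x)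
    {f : Module.Dual K V} (hf : ∀ k ∈ H, ∀ x, f (k x) = f x)
    {g : V ≃ₗ[K] V} (hg : g ∈ G) (x : V) : f (g x) = f x := by
  classical
  have : Finite H := _root_.Finite.of_injective _ (Subgroup.inclusion_injective hHG)
  have := Fintype.ofFinite G
  have := Fintype.ofFinite H
  have hG0 : (Fintype.card G : K) ≠ 0 := by simp
  have hH0 : (Fintype.card H : K) ≠ 0 := by simp
  have key (y : V) : (Fintype.card G : K) * f y = f (∑ k : G, (k : V ≃ₗ[K] V) y) := by
    have h₁ : ∑ k : G, (k : V ≃ₗ[K] V) (∑ l : H, (l : V ≃ₗ[K] V) y) =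
        (Fintype.card G : K) • ∑ l : H, (l : V ≃ₗ[K] V) y := by
      rw [Finset.sum_congr rfl fun (k : G) _ ↦ hfix _
        (fun _ hl ↦ LinearEquiv.apply_sum_subgroup_apply H hl y) k k.2]
      simp [Nat.cast_smul_eq_nsmul]
    have h₂ : ∑ k : G, (k : V ≃ₗ[K] V) (∑ l : H, (l : V ≃ₗ[K] V) y) =
        (Fintype.card H : K) • ∑ k : G, (k : V ≃ₗ[K] V) y := by
      simp_rw [map_sum]
      rw [Finset.sum_comm, Finset.sum_congr rfl fun (l : H) _ ↦
        LinearEquiv.sum_subgroup_apply_apply G (hHG l.2) y]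
      simp [Nat.cast_smul_eq_nsmul]
    have h₃ : f (∑ l : H, (l : V ≃ₗ[K] V) y) = (Fintype.card H : K) * f y := by
      rw [map_sum, Finset.sum_congr rfl fun (l : H) _ ↦ hf l l.2 y]
      simp
    have h₄ := congrArg f (h₁.symm.trans h₂)
    rw [map_smul, map_smul, h₃, smul_eq_mul, smul_eq_mul] at h₄
    exact mul_left_cancel₀ hH0 (by linear_combination h₄)
  refine mul_left_cancel₀ hG0 ?_
  rw [key, key, LinearEquiv.sum_subgroup_apply_apply G hg]

/-- A subspace contains a vector such that any element of a given finite set of linear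
automorphisms fixing this vector fixes the whole subspace. -/
theorem Submodule.exists_mem_forall_apply_eq_imp {K V : Type*} [Field K] [Infinite K]
    [AddCommGroup V] [Module K V] (W : Submodule K V) {S : Set (V ≃ₗ[K] V)} (hS : S.Finite) :
    ∃ u ∈ W, ∀ g ∈ S, g u = u → ∀ x ∈ W, g x = x := by
  classical
  let E (g : V ≃ₗ[K] V) : Submodule K W :=
    LinearMap.eqLocus ((g : V →ₗ[K] V) ∘ₗ W.subtype) W.subtype
  let s : Finset (Submodule K W) := (hS.toFinset.image E).filter (· ≠ ⊤)
  have hs := Subspace.biUnion_ne_univ_of_top_notMem (s := s) (by simp [s])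
  obtain ⟨u, hu⟩ := (Set.ne_univ_iff_exists_notMem _).1 hs
  refine ⟨u, u.2, fun g hg hgu x hx ↦ ?_⟩
  have hE : E g = ⊤ := by
    by_contra hne
    refine hu (Set.mem_iUnion₂.2 ⟨E g, ?_, hgu⟩)
    exact Finset.mem_filter.2 ⟨Finset.mem_image_of_mem _ (hS.mem_toFinset.2 hg), hne⟩
  have hxE : (⟨x, hx⟩ : W) ∈ E g := hE ▸ Submodule.mem_top
  exact hxE


/-- For a finite complex reflection group `Γ ⊆ GL(h)` (generated by its
reflections, i.e. elements `g` with `rank (g - 1) = 1`), a subgroup `Γ'` of `Γ` is the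
stabilizer of some vector of `h` if and only if it is the stabilizer of some vector of
`h ⊕ h*`, where `Γ` acts on the dual `h*` by the contragredient action
`(γ · f)(v) = f (γ⁻¹ v)`. -/
theorem stabilizer_h_iff_stabilizer_h_oplus_dual
    {V : Type*} [AddCommGroup V] [Module ℂ V] [FiniteDimensional ℂ V]
    (Γ : Subgroup (V ≃ₗ[ℂ] V)) [Finite Γ]
    (hrefl : Γ = Subgroup.closure
      {g : V ≃ₗ[ℂ] V | g ∈ Γ ∧
        Module.finrank ℂ (LinearMap.range ((g : V →ₗ[ℂ] V) - LinearMap.id)) = 1})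
    (Γ' : Subgroup (V ≃ₗ[ℂ] V)) (hΓ'Γ : Γ' ≤ Γ) :
    (∃ v : V, ∀ g ∈ Γ, (g ∈ Γ' ↔ g v = v)) ↔
      (∃ p : V × Module.Dual ℂ V, ∀ g ∈ Γ,
        (g ∈ Γ' ↔ (g p.1 = p.1 ∧
          p.2 ∘ₗ ((g⁻¹ : V ≃ₗ[ℂ] V) : V →ₗ[ℂ] V) = p.2))) := by

  constructor
  · rintro ⟨v, hv⟩
    exact ⟨(v, 0), fun g hg ↦ by simp [hv g hg]⟩
  rintro ⟨⟨v, f⟩, hp⟩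
  dsimp only at hp
  let W : Submodule ℂ V :=
    { carrier := {x | ∀ k ∈ Γ', k x = x}
      add_mem' := fun ha hb k hk ↦ by rw [map_add, ha k hk, hb k hk]
      zero_mem' := fun k _ ↦ map_zero k
      smul_mem' := fun c x hx k hk ↦ by rw [map_smul, hx k hk] }
  let G : Subgroup (V ≃ₗ[ℂ] V) := Γ ⊓
    { carrier := {k | ∀ x ∈ W, k x = x}
      mul_mem' := fun {a b} ha hb x hx ↦ by rw [LinearEquiv.mul_apply, hb x hx, ha x hx]
      one_mem' := fun _ _ ↦ rfl
      inv_mem' := fun {a} ha x hx ↦ a.symm_apply_eq.2 (ha x hx).symm }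
  have hGΓ : G ≤ Γ := inf_le_left
  have : Finite G := Finite.of_injective _ (Subgroup.inclusion_injective hGΓ)
  have hΓ'G : Γ' ≤ G := fun k hk ↦ ⟨hΓ'Γ hk, fun _ hx ↦ hx k hk⟩
  have hf : ∀ k ∈ Γ', ∀ x, f (k x) = f x := fun k hk x ↦ by
    simpa using LinearMap.congr_fun
      ((hp k⁻¹ (Γ.inv_mem (hΓ'Γ hk))).1 (Γ'.inv_mem hk)).2 x
  obtain ⟨u, huW, hu⟩ := W.exists_mem_forall_apply_eq_imp (Set.toFinite (Γ : Set (V ≃ₗ[ℂ] V)))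
  refine ⟨u, fun g hg ↦ ⟨fun hgΓ' ↦ huW g hgΓ', fun hgu ↦ ?_⟩⟩
  have hgG : g ∈ G := ⟨hg, hu g hg hgu⟩
  refine (hp g hg).2 ⟨hgG.2 v fun k hk ↦ ((hp k (hΓ'Γ hk)).1 hk).1, LinearMap.ext fun x ↦ ?_⟩
  exact Module.Dual.apply_eq_of_fixed_vectors_eq hΓ'G (fun x hx k hk ↦ hk.2 x hx) hf
    (G.inv_mem hgG) x
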